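/- arXiv:2403.01867 — 8 statements merged into one kernel-verified Lean document; each statement's English description precedes it below -/
import Mathlib

section
/- For all natural numbers n and z, there exists a natural number k with k ≥ 1, 2*k ≤ n and n ≤ k*z if and only if either (z = 2 and n is even and 2 ≤ n) or (2 < z and 2 ≤ n). (This is the arithmetic core of the paper's Lemma 1: the existentially quantified non-linear summary ∃k ≥ 1. 2k ≤ y−x ≤ k·z of a non-empty heap-list atom hls(x,y;z) is equivalent to the quantifier-free Presburger formula (z = 2 ∧ 2 ≤ y−x ∧ y−x ≡ 0 mod 2) ∨ (2 < z ∧ 2 ≤ y−x).) -/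
theorem hls_summary (n z : ℕ) :
    (∃ k : ℕ, 1 ≤ k ∧ 2 * k ≤ n ∧ n ≤ k * z) ↔
      ((z = 2 ∧ Even n ∧ 2 ≤ n) ∨ (2 < z ∧ 2 ≤ n)) := by
  constructor
  · rintro ⟨k, hk, hkn, hnz⟩
    have hz : 2 ≤ z := by
      by_contra! h
      have : k * z ≤ k * 1 := Nat.mul_le_mul_left k (by omega)
      omega
    rcases hz.eq_or_lt with rfl | hz
    · exact Or.inl ⟨rfl, ⟨k, by omega⟩, by omega⟩
    · exact Or.inr ⟨hz, by omega⟩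
  · rintro (⟨rfl, ⟨k, rfl⟩, hn⟩ | ⟨hz, hn⟩)
    · exact ⟨k, by omega, by omega, by omega⟩
    · have : n / 2 * 3 ≤ n / 2 * z := Nat.mul_le_mul_left _ hz
      exact ⟨n / 2, by omega, by omega, by omega⟩
end

section
/- For all natural numbers n, B and z, there exists a list L of natural numbers with z ∈ L, every element s of L satisfying 2 ≤ s and s ≤ B, and L.sum = n, if and only if either (B = 2 and z = 2 and 2 ≤ n and n is even) or (2 < B and 2 ≤ z and z ≤ B and (z + 2 ≤ n or n = z)). (This characterizes, in quantifier-free Presburger arithmetic, when the value z appears as a chunk size in some unfolding scheme for (n, B); it is the first step in the paper's proof of Lemma 2.) -/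
/-- Every natural number other than `1` is a sum of `2`s and `3`s. -/
lemma exists_list_two_three_sum_eq {m : ℕ} (hm : m ≠ 1) :
    ∃ L : List ℕ, (∀ s ∈ L, 2 ≤ s ∧ s ≤ 3) ∧ L.sum = m := by
  induction m using Nat.strong_induction_on with
  | _ m ih =>
    obtain rfl | rfl | hm' : m = 0 ∨ m = 3 ∨ (2 ≤ m ∧ m - 2 ≠ 1) := by omega
    · exact ⟨[], by simp⟩
    · exact ⟨[3], by simp⟩
    · obtain ⟨L, hL, hsum⟩ := ih (m - 2) (by omega) hm'.2
      exact ⟨2 :: L, by simpa using hL, by rw [List.sum_cons]; omega⟩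

lemma list_sum_ne_one {L : List ℕ} (hL : ∀ s ∈ L, 2 ≤ s) : L.sum ≠ 1 := by
  cases L with
  | nil => simp
  | cons a L =>
    have := hL a List.mem_cons_self
    rw [List.sum_cons]
    omega

theorem chunk_size_realizable (n B z : ℕ) :
    (∃ L : List ℕ, z ∈ L ∧ (∀ s ∈ L, 2 ≤ s ∧ s ≤ B) ∧ L.sum = n) ↔
      ((B = 2 ∧ z = 2 ∧ 2 ≤ n ∧ Even n) ∨
       (2 < B ∧ 2 ≤ z ∧ z ≤ B ∧ (z + 2 ≤ n ∨ n = z))) := by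
  constructor
  · rintro ⟨L, hz, hL, rfl⟩
    have hzB := hL z hz
    have hsum : z + (L.erase z).sum = L.sum := List.sum_erase hz
    have hrest : (L.erase z).sum ≠ 1 :=
      list_sum_ne_one fun s hs => (hL s (List.mem_of_mem_erase hs)).1
    obtain rfl | hB : B = 2 ∨ 2 < B := by omega
    · refine .inl ⟨rfl, by omega, by omega, even_iff_two_dvd.2 (List.dvd_sum fun s hs => ?_)⟩
      have := hL s hs
      exact dvd_of_eq (by omega)
    · exact .inr ⟨hB, hzB.1, hzB.2, by omega⟩
  · rintro (⟨rfl, rfl, hn, k, rfl⟩ | ⟨hB, hz, hzB, hn⟩)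
    · exact ⟨List.replicate k 2, List.mem_replicate.2 ⟨by omega, rfl⟩,
        fun s hs => by simp [List.eq_of_mem_replicate hs],
        by rw [List.sum_replicate, smul_eq_mul, mul_two]⟩
    · obtain ⟨L, hL, hsum⟩ := exists_list_two_three_sum_eq (m := n - z) (by omega)
      refine ⟨z :: L, List.mem_cons_self, ?_, by rw [List.sum_cons]; omega⟩
      rintro s (_ | ⟨_, hs⟩)
      · exact ⟨hz, hzB⟩
      · exact ⟨(hL s hs).1, (hL s hs).2.trans hB⟩
end

section
/- Let x, y, v, v' be natural numbers with x < y, and suppose there exists a heap h0 with HeapList h0 x y v'. Then the following are equivalent: (1) every heap h satisfying HeapList h x y v' also satisfies HeapList h x y v; (2) for every natural number z, if there exists a list L of natural numbers with z ∈ L, every element s of L satisfying 2 ≤ s and s ≤ v', and L.sum = y − x, then z ≤ v. (This is the semantic content of the paper's Lemma 3: a non-empty heap-list atom hls(x,y;v') entails hls(x,y;v) exactly when the effective upper bound of chunk sizes realizable under the bound v' is at most v; in particular the entailment may hold even when v' > v.) -/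
/-- The domain of a heap. -/
def Dom (h : ℕ → Option ℕ) : Set ℕ := {n : ℕ | h n ≠ none}

/-- The heap-list predicate `hls(x, y; v)`: the heap `h` consists of consecutive
chunks from `x` to `y`, each of size between `2` and `v`, each storing its size
in its header cell. -/
def HeapList (h : ℕ → Option ℕ) (x y v : ℕ) : Prop :=
  Dom h = Set.Ico x y ∧
  ∃ (l : ℕ) (a : ℕ → ℕ), a 0 = x ∧ a l = y ∧
    ∀ i < l, a i + 2 ≤ a (i + 1) ∧ a (i + 1) ≤ a i + v ∧
      h (a i) = some (a (i + 1) - a i)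

/-- The positions of the chunks of sizes `L` laid out from `x` on; past the end of `L` the
positions go on in steps of `2`. -/
def chunkStart (x : ℕ) (L : List ℕ) (i : ℕ) : ℕ :=
  x + ∑ j ∈ Finset.range i, L.getD j 2

theorem chunkStart_succ (x : ℕ) (L : List ℕ) (i : ℕ) :
    chunkStart x L (i + 1) = chunkStart x L i + L.getD i 2 := by
  simp only [chunkStart, Finset.sum_range_succ, add_assoc]

theorem chunkStart_length (x : ℕ) (L : List ℕ) :
    chunkStart x L L.length = x + L.sum := by
  simp [chunkStart, Finset.sum_range]

theorem strictMono_chunkStart (x : ℕ) {L : List ℕ} (hL : ∀ s ∈ L, 0 < s) :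
    StrictMono (chunkStart x L) := by
  refine strictMono_nat_of_lt_succ fun i => ?_
  rw [chunkStart_succ]
  by_cases hi : i < L.length
  · rw [List.getD_eq_getElem _ _ hi]
    have := hL _ (List.getElem_mem hi)
    lia
  · rw [List.getD_eq_default _ _ (not_lt.mp hi)]
    lia

open Classical in
/-- The heap on `[x, x + L.sum)` whose chunks have the sizes `L`; cells other than headers
hold `0`. -/
noncomputable def chunkHeap (x : ℕ) (L : List ℕ) (n : ℕ) : Option ℕ :=
  if n ∈ Set.Ico x (x + L.sum) then
    some (Function.extend (chunkStart x L) (fun i => L.getD i 2) 0 n)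
  else none

theorem dom_chunkHeap (x : ℕ) (L : List ℕ) :
    Dom (chunkHeap x L) = Set.Ico x (x + L.sum) := by
  ext n
  simp [Dom, chunkHeap]

theorem chunkHeap_chunkStart (x : ℕ) {L : List ℕ} (hL : ∀ s ∈ L, 0 < s) {i : ℕ}
    (hi : i < L.length) : chunkHeap x L (chunkStart x L i) = some (L.getD i 2) := by
  have hmono := strictMono_chunkStart x hL
  have hlt := hmono hi
  rw [chunkStart_length] at hlt
  rw [chunkHeap, if_pos ⟨Nat.le_add_right _ _, hlt⟩, hmono.injective.extend_apply]

theorem heapList_chunkHeap (x : ℕ) {L : List ℕ} {v : ℕ} (hL : ∀ s ∈ L, 2 ≤ s ∧ s ≤ v) :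
    HeapList (chunkHeap x L) x (x + L.sum) v := by
  refine ⟨dom_chunkHeap x L, L.length, chunkStart x L, by simp [chunkStart],
    chunkStart_length x L, fun i hi => ?_⟩
  rw [chunkHeap_chunkStart x (fun s hs => two_pos.trans_le (hL s hs).1) hi, chunkStart_succ,
    Nat.add_sub_cancel_left]
  have h := hL _ (List.getElem_mem hi)
  rw [← List.getD_eq_getElem _ 2 hi] at h
  exact ⟨by lia, by lia, rfl⟩

/-- The headers of `chunkHeap x L` determine its decomposition into chunks, so every bound
valid for it as a heap list bounds all of `L`. -/
theorem le_of_heapList_chunkHeap {x : ℕ} {L : List ℕ} {v : ℕ} (hL : ∀ s ∈ L, 0 < s)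
    (h : HeapList (chunkHeap x L) x (x + L.sum) v) : ∀ s ∈ L, s ≤ v := by
  obtain ⟨-, l, b, hb0, hbl, hb⟩ := h
  have hmono := strictMono_chunkStart x hL
  have hbound : ∀ i < l, b i < x + L.sum := by
    intro i hi
    by_contra hge
    have := (hb i hi).2.2
    rw [chunkHeap, if_neg fun hmem => hge hmem.2] at this
    cases this
  have hstep : ∀ i < l, b i = chunkStart x L i →
      i < L.length ∧ b (i + 1) = b i + L.getD i 2 := by
    intro i hi heq
    have hlen : i < L.length := by
      rw [← hmono.lt_iff_lt, chunkStart_length, ← heq]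
      exact hbound i hi
    obtain ⟨h1, -, h3⟩ := hb i hi
    rw [heq, chunkHeap_chunkStart x hL hlen, ← heq, Option.some_inj] at h3
    exact ⟨hlen, by lia⟩
  have hstart : ∀ i ≤ l, b i = chunkStart x L i := by
    intro i
    induction i with
    | zero => simp [hb0, chunkStart]
    | succ i ih =>
      intro hi
      have heq := ih (Nat.le_of_succ_le hi)
      rw [(hstep i hi heq).2, chunkStart_succ, heq]
  have hl : l = L.length := by
    apply hmono.injective
    rw [← hstart l le_rfl, hbl, chunkStart_length]
  intro s hs
  obtain ⟨i, hi, rfl⟩ := List.getElem_of_mem hs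
  have hil : i < l := hl ▸ hi
  have h1 := (hstep i hil (hstart i hil.le)).2
  have h2 := (hb i hil).2.1
  rw [List.getD_eq_getElem _ _ hi] at h1
  lia

theorem sum_map_range_tsub {l : ℕ} {a : ℕ → ℕ} (ha : ∀ i < l, a i ≤ a (i + 1)) :
    a 0 + ((List.range l).map fun i => a (i + 1) - a i).sum = a l := by
  induction l with
  | zero => simp
  | succ l ih =>
    have h1 := ih fun i hi => ha i (hi.trans l.lt_succ_self)
    have h2 := ha l l.lt_succ_self
    rw [List.range_succ, List.map_append, List.sum_append, List.map_singleton,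
      List.sum_singleton]
    lia

theorem hls_entails_hls_iff_eub (x y v v' : ℕ) (hxy : x < y)
    (hne : ∃ h0 : ℕ → Option ℕ, HeapList h0 x y v') :
    (∀ h : ℕ → Option ℕ, HeapList h x y v' → HeapList h x y v) ↔
      (∀ z : ℕ,
        (∃ L : List ℕ, z ∈ L ∧ (∀ s ∈ L, 2 ≤ s ∧ s ≤ v') ∧ L.sum = y - x) →
        z ≤ v) := by
  constructor
  · rintro H z ⟨L, hz, hL, hsum⟩
    obtain rfl : y = x + L.sum := by lia
    exact le_of_heapList_chunkHeap (fun s hs => two_pos.trans_le (hL s hs).1)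
      (H _ (heapList_chunkHeap x hL)) z hz
  · rintro H h ⟨hdom, l, a, rfl, rfl, ha⟩
    refine ⟨hdom, l, a, rfl, rfl, fun i hi => ?_⟩
    obtain ⟨h1, -, h3⟩ := ha i hi
    have hz := H (a (i + 1) - a i) ⟨(List.range l).map fun i => a (i + 1) - a i,
      List.mem_map.mpr ⟨i, List.mem_range.mpr hi, rfl⟩, ?_, ?_⟩
    · exact ⟨h1, by lia, h3⟩
    · intro s hs
      obtain ⟨j, hj, rfl⟩ := List.mem_map.mp hs
      obtain ⟨h1, h2, -⟩ := ha j (List.mem_range.mp hj)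
      lia
    · have := sum_map_range_tsub (l := l) (a := a) fun i hi => by
        have := (ha i hi).1
        lia
      lia
end

section
/- For all natural numbers x, y, v: there exists a heap h with HeapList h x y v if and only if x = y, or (x < y and ((v = 2 and y − x is even and 2 ≤ y − x) or (2 < v and 2 ≤ y − x))). (This is the heap-list case of the paper's Proposition 1: a stack value assignment satisfies the Presburger abstraction Abs(hls(x,y;v)) exactly when some heap realizes the atom hls(x,y;v).) -/
/-- A heap list is realized by chunks of size `2`, except that the first chunk has size `3`
when the total length is odd. -/
theorem exists_heapList {x y v : ℕ} (hxy : x + 2 ≤ y) (hv : 2 + (y - x) % 2 ≤ v) :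
    ∃ h : ℕ → Option ℕ, HeapList h x y v := by
  refine ⟨fun n => if x ≤ n ∧ n < y then some (if n = x then 2 + (y - x) % 2 else 2) else none,
    ?_, (y - x) / 2, fun i => if i = 0 then x else x + 2 * i + (y - x) % 2, ?_, ?_, ?_⟩
  · ext n
    simp [Dom]
  · simp
  · dsimp only
    split_ifs <;> omega
  · intro i hi
    rcases Nat.eq_zero_or_pos i with rfl | hpos
    · have hlt : x < y := by omega
      simp [hlt]
      omega
    · have hi0 : i ≠ 0 := by omega
      have hmem : x ≤ x + 2 * i + (y - x) % 2 ∧ x + 2 * i + (y - x) % 2 < y := by omega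
      have hne : x + 2 * i + (y - x) % 2 ≠ x := by omega
      simp only [hi0, Nat.succ_ne_zero, if_false, if_pos hmem, hne, Option.some.injEq]
      omega

/-- A sequence of `l` steps of size between `2` and `v` advances by between `2 * l` and `v * l`. -/
theorem chunk_bounds {a : ℕ → ℕ} {v l : ℕ}
    (ha : ∀ i < l, a i + 2 ≤ a (i + 1) ∧ a (i + 1) ≤ a i + v) :
    a 0 + 2 * l ≤ a l ∧ a l ≤ a 0 + v * l := by
  induction l with
  | zero => simp
  | succ l ih =>
    have hl := ha l (by omega)
    have := ih fun i hi => ha i (by omega)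
    rw [Nat.mul_succ, Nat.mul_succ]
    omega

theorem hls_abstraction_correct (x y v : ℕ) :
    (∃ h : ℕ → Option ℕ, HeapList h x y v) ↔
      (x = y ∨
       (x < y ∧ ((v = 2 ∧ Even (y - x) ∧ 2 ≤ y - x) ∨ (2 < v ∧ 2 ≤ y - x)))) := by
  constructor
  · rintro ⟨h, -, l, a, rfl, rfl, ha⟩
    have hb := chunk_bounds fun i hi => ⟨(ha i hi).1, (ha i hi).2.1⟩
    rcases Nat.eq_zero_or_pos l with rfl | hl
    · exact Or.inl rfl
    · have hstep := ha 0 hl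
      rcases (show v = 2 ∨ 2 < v by omega) with rfl | hv
      · exact Or.inr ⟨by omega, Or.inl ⟨rfl, ⟨l, by omega⟩, by omega⟩⟩
      · exact Or.inr ⟨by omega, Or.inr ⟨hv, by omega⟩⟩
  · rintro (rfl | ⟨hxy, ⟨rfl, heven, hd⟩ | ⟨hv, hd⟩⟩)
    · exact ⟨fun _ => none, by simp [Dom], 0, fun _ => x, rfl, rfl, by simp⟩
    · rw [Nat.even_iff] at heven
      exact exists_heapList (by omega) (by omega)
    · exact exists_heapList (by omega) (by omega)
end

section
/- Let h : ℕ → Option ℕ, let x, y be natural numbers, and let ℓ, ℓ' : ℕ and a, a' : ℕ → ℕ satisfy: a 0 = x, a ℓ = y, and for every i < ℓ, a i + 2 ≤ a (i+1) and h (a i) = some (a (i+1) - a i); and likewise a' 0 = x, a' ℓ' = y, and for every i < ℓ', a' i + 2 ≤ a' (i+1) and h (a' i) = some (a' (i+1) - a' i). Then ℓ = ℓ' and a i = a' i for all i ≤ ℓ. (The chunk decomposition of a heap list is unique: since each chunk header stores the chunk's size, the chain of chunk-start addresses from x to y determined by h is unique. This claim is used in the paper's proof of Lemma 3 when matching the chunks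 of the antecedent heap to unfoldings of the consequent heap-list atom.) -/
/-- Addresses increase strictly along a chain. -/
theorem chain_lt_end {a : ℕ → ℕ} {l : ℕ} (ha : ∀ i < l, a i + 2 ≤ a (i + 1)) {i : ℕ}
    (hi : i < l) : a i < a l := by
  induction l with
  | zero => omega
  | succ k ih =>
    have hk := ha k (by omega)
    rcases Nat.lt_succ_iff_lt_or_eq.mp hi with h | rfl
    · have := ih (fun j hj => ha j (by omega)) h
      omega
    · omega

/-- Two chains with the same start agree as long as both are running. -/
theorem chain_agree {h : ℕ → Option ℕ} {l l' : ℕ} {a a' : ℕ → ℕ} (h0 : a 0 = a' 0)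
    (ha : ∀ i < l, a i + 2 ≤ a (i + 1) ∧ h (a i) = some (a (i + 1) - a i))
    (ha' : ∀ i < l', a' i + 2 ≤ a' (i + 1) ∧ h (a' i) = some (a' (i + 1) - a' i))
    {i : ℕ} (hi : i ≤ l) (hi' : i ≤ l') : a i = a' i := by
  induction i with
  | zero => exact h0
  | succ k ih =>
    have hk := ih (by omega) (by omega)
    obtain ⟨h1, h2⟩ := ha k (by omega)
    obtain ⟨h1', h2'⟩ := ha' k (by omega)
    rw [hk, h2', Option.some.injEq] at h2
    omega

theorem chain_unique (h : ℕ → Option ℕ) (x y : ℕ) (l l' : ℕ) (a a' : ℕ → ℕ)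
    (ha0 : a 0 = x) (hal : a l = y)
    (ha : ∀ i < l, a i + 2 ≤ a (i + 1) ∧ h (a i) = some (a (i + 1) - a i))
    (ha0' : a' 0 = x) (hal' : a' l' = y)
    (ha' : ∀ i < l', a' i + 2 ≤ a' (i + 1) ∧ h (a' i) = some (a' (i + 1) - a' i)) :
    l = l' ∧ ∀ i ≤ l, a i = a' i := by
  have agree : ∀ i ≤ l, i ≤ l' → a i = a' i := fun i hi hi' =>
    chain_agree (ha0.trans ha0'.symm) ha ha' hi hi'
  have hll' : l = l' := by
    rcases lt_trichotomy l l' with hlt | heq | hgt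
    · have h1 := chain_lt_end (fun i hi => (ha' i hi).1) hlt
      have h2 := agree l le_rfl hlt.le
      omega
    · exact heq
    · have h1 := chain_lt_end (fun i hi => (ha i hi).1) hgt
      have h2 := agree l' hgt.le le_rfl
      omega
  exact ⟨hll', fun i hi => agree i hi (hll' ▸ hi)⟩
end

section
/- Let x, v be natural numbers and let L be a list of natural numbers such that every element s of L satisfies 2 ≤ s and s ≤ v. Then there exists a heap h such that HeapList h x (x + L.sum) v, and moreover for every i < L.length, h (x + (L.take i).sum) = some (L.get i). (Every unfolding scheme is realizable: given any sequence of intended chunk sizes within the bound, some heap is a heap list with exactly those chunk sizes. This claim is used in the 'only if' direction of the paper's proof of Lemma 3.) -/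
/-- Any sequence of positive chunk sizes is stored in the headers of some heap whose domain is
exactly the interval covered by the chunks. -/
theorem exists_heap_with_headers (L : List ℕ) (hL : ∀ s ∈ L, 0 < s) (x : ℕ) :
    ∃ h : ℕ → Option ℕ, Dom h = Set.Ico x (x + L.sum) ∧
      ∀ (i : ℕ) (hi : i < L.length), h (x + (L.take i).sum) = some L[i] := by
  induction L generalizing x with
  | nil => exact ⟨fun _ => none, by simp [Dom], by simp⟩
  | cons s L ih =>
    obtain ⟨h, hdom, hhead⟩ := ih (fun t ht => hL t (List.mem_cons_of_mem s ht)) (x + s)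
    have hs : 0 < s := hL s List.mem_cons_self
    refine ⟨fun n => if n < x + s then if x ≤ n then some s else none else h n, ?_, ?_⟩
    · ext n
      have hn : h n ≠ none ↔ x + s ≤ n ∧ n < x + s + L.sum := Set.ext_iff.mp hdom n
      simp only [Dom, Set.mem_ofPred_eq, Set.mem_Ico, List.sum_cons]
      split_ifs with h₁ h₂
      · simp only [ne_eq, reduceCtorEq, not_false_eq_true, true_iff]
        omega
      · simp [h₂]
      · rw [hn]
        omega
    · rintro (_ | i) hi
      · simp [hs]
      · simpa [add_assoc] using hhead i (Nat.lt_of_succ_lt_succ hi)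

theorem unfolding_scheme_realizable (x v : ℕ) (L : List ℕ)
    (hL : ∀ s ∈ L, 2 ≤ s ∧ s ≤ v) :
    ∃ h : ℕ → Option ℕ, HeapList h x (x + L.sum) v ∧
      ∀ i : Fin L.length, h (x + (L.take i.1).sum) = some (L.get i) := by
  obtain ⟨h, hdom, hhead⟩ :=
    exists_heap_with_headers L (fun s hs => Nat.lt_of_lt_of_le Nat.two_pos (hL s hs).1) x
  refine ⟨h, ⟨hdom, L.length, fun i => x + (L.take i).sum, by simp, by simp, fun i hi => ?_⟩,
    fun i => hhead i.1 i.2⟩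
  have hsum : (L.take (i + 1)).sum = (L.take i).sum + L[i] := List.sum_take_succ L i hi
  have hbound := hL L[i] (List.getElem_mem hi)
  simp only [hsum, hhead i hi, Option.some.injEq]
  omega
end

section
/- Let h1, h2 : ℕ → Option ℕ be heaps and x, y, z, v natural numbers such that HeapList h1 x y v and HeapList h2 y z v. Then the domains of h1 and h2 are disjoint, and the combined heap h defined by h n = (h1 n).orElse (h2 n) satisfies HeapList h x z v. (ection This is the paper's composition lemma for the heap-list predicate: hls(x,y;v) ∗ hls(y,z;v) ⊨ hls(x,z;v), showing that hls is a compositional predicate.) -/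
theorem apply_zero_le_of_forall_le_succ {l : ℕ} {a : ℕ → ℕ} (ha : ∀ i < l, a i ≤ a (i + 1)) {i : ℕ}
    (hi : i ≤ l) : a 0 ≤ a i := by
  induction i with
  | zero => exact le_rfl
  | succ k ih => exact (ih (by omega)).trans (ha k (by omega))

theorem mem_dom_iff {h : ℕ → Option ℕ} {n : ℕ} : n ∈ Dom h ↔ h n ≠ none := Iff.rfl

theorem dom_orElse (h1 h2 : ℕ → Option ℕ) :
    Dom (fun n => (h1 n).orElse (fun _ => h2 n)) = Dom h1 ∪ Dom h2 := by
  ext n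
  simp only [mem_dom_iff, Set.mem_union]
  cases h1 n <;> simp

theorem hls_composition (h1 h2 : ℕ → Option ℕ) (x y z v : ℕ)
    (H1 : HeapList h1 x y v) (H2 : HeapList h2 y z v) :
    Disjoint (Dom h1) (Dom h2) ∧
      HeapList (fun n => (h1 n).orElse (fun _ => h2 n)) x z v := by
  obtain ⟨hd1, l, a, ha0, hal, ha⟩ := H1
  obtain ⟨hd2, m, b, hb0, hbm, hb⟩ := H2
  have hxy : x ≤ y := by
    have := apply_zero_le_of_forall_le_succ (a := a)
      (fun i hi => by have := (ha i hi).1; omega) (le_refl l)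
    omega
  have hyb : ∀ i ≤ m, y ≤ b i := fun i hi => by
    have := apply_zero_le_of_forall_le_succ (a := b) (fun i hi => by have := (hb i hi).1; omega) hi
    omega
  have hyz : y ≤ z := hbm ▸ hyb m le_rfl
  refine ⟨?_, ?_, l + m, fun i => if i ≤ l then a i else b (i - l), ?_, ?_, ?_⟩
  · rw [hd1, hd2]
    exact Set.Ico_disjoint_Ico_same
  · rw [dom_orElse, hd1, hd2, Set.Ico_union_Ico_eq_Ico hxy hyz]
  · simpa using ha0
  · rcases Nat.eq_zero_or_pos m with rfl | hm
    · simp only [Nat.add_zero, le_refl, if_true]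
      omega
    · simpa [show ¬ m = 0 by omega] using hbm
  · intro i hi
    rcases lt_or_ge i l with hil | hil
    · simpa [hil.le, Nat.succ_le_of_lt hil, (ha i hil).2.2] using ha i hil
    · obtain ⟨j, rfl⟩ := Nat.exists_eq_add_of_le hil
      have hcur : (if l + j ≤ l then a (l + j) else b (l + j - l)) = b j := by
        rcases Nat.eq_zero_or_pos j with rfl | hj
        · simp [hal, hb0]
        · simp [show ¬ j = 0 by omega]
      have hnext : (if l + j + 1 ≤ l then a (l + j + 1) else b (l + j + 1 - l)) = b (j + 1) := by
        rw [if_neg (by omega), show l + j + 1 - l = j + 1 by omega]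
      have hnone : h1 (b j) = none := by
        by_contra hne
        have hmem : b j ∈ Set.Ico x y := hd1 ▸ mem_dom_iff.2 hne
        exact absurd hmem.2 (hyb j (by omega)).not_gt
      simp only [hcur, hnext, hnone, Option.orElse_none]
      exact hb j (by omega)
end

section
/- For all natural numbers x and y: there exists a heap h with HeapListU h x y if and only if x = y or x + 2 ≤ y. (This is the summary of the unbounded heap-list atom hls(x,y) = hls(x,y;∞) used in the paper's satisfiability abstraction: Abs(hls(t1,t2)) is t1 = t2 ∨ 2 ≤ t2 − t1.) -/
/-- The unbounded heap-list predicate `hls(x, y)`: no upper bound on chunk sizes. -/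
def HeapListU (h : ℕ → Option ℕ) (x y : ℕ) : Prop :=
  Dom h = Set.Ico x y ∧
  ∃ (l : ℕ) (a : ℕ → ℕ), a 0 = x ∧ a l = y ∧
    ∀ i < l, a i + 2 ≤ a (i + 1) ∧ h (a i) = some (a (i + 1) - a i)

/-- A sequence that grows by at least two at each of its first `l` steps grows by at least
`2 * l` in total. -/
theorem add_two_mul_le_of_forall_add_two_le {a : ℕ → ℕ} {l : ℕ}
    (h : ∀ i < l, a i + 2 ≤ a (i + 1)) : a 0 + 2 * l ≤ a l := by
  induction l with
  | zero => simp
  | succ k ih =>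
    have := ih fun i hi => h i (by omega)
    have := h k (by omega)
    omega

theorem hlsU_abstraction_correct (x y : ℕ) :
    (∃ h : ℕ → Option ℕ, HeapListU h x y) ↔ (x = y ∨ x + 2 ≤ y) := by
  constructor
  · rintro ⟨h, -, l, a, rfl, rfl, ha⟩
    have := add_two_mul_le_of_forall_add_two_le fun i hi => (ha i hi).1
    rcases l with _ | l
    · exact Or.inl rfl
    · right
      omega
  · rintro (rfl | hxy)
    · exact ⟨fun _ => none, by simp [Dom], 0, fun _ => x, rfl, rfl, by simp⟩
    · refine ⟨fun n => if n ∈ Set.Ico x y then some (y - x) else none, ?_, 1,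
        fun i => if i = 0 then x else y, rfl, rfl, ?_⟩
      · ext n
        simp [Dom]
      · intro i hi
        obtain rfl : i = 0 := by omega
        have : x < y := by omega
        simp [hxy, this]
end
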